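/- arXiv:1703.05655 — 4 statements merged into one kernel-verified Lean document; each statement's English description precedes it below -/
import Mathlib

section
/- Let T be a rooted chain complete tree, endowed with the coarse wedge topology. Then T has a retractional skeleton if and only if T satisfies condition (*): every t ∈ T such that cf(t) ≥ ω₁ has at most finitely many immediate successors. -/
open Cardinal Ordinal Filter Set Topology

universe u v

section TreeDefs

variable {T : Type u} [PartialOrder T]

/-- `T` is a tree: the set of strict predecessors of every point is well-ordered by `<`. -/
def IsTreeOrder (T : Type u) [PartialOrder T] : Prop :=
  ∀ x : T, IsWellOrder {y : T // y < x} (· < ·)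

/-- Every chain has a supremum. -/
def ChainComplete (T : Type u) [PartialOrder T] : Prop :=
  ∀ c : Set T, IsChain (· ≤ ·) c → ∃ s, IsLUB c s

open Classical in
/-- The height `ht(x,T)` of `x`: the order type of the set of its strict predecessors. -/
noncomputable def htx (x : T) : Ordinal.{u} :=
  if h : IsWellOrder {y : T // y < x} (· < ·) then @Ordinal.type {y : T // y < x} (· < ·) h
  else 0

/-- The cofinality `cf(x)` of `ht(x,T)`. -/
noncomputable def cfx (x : T) : Cardinal.{u} := (htx x).cof

/-- `x` lies on a successor level. -/
def SuccLevel (x : T) : Prop := ∃ β : Ordinal, htx x = β + 1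

/-- The set of immediate successors of `x`. -/
def ims (x : T) : Set T := {y | x < y ∧ htx y = htx x + 1}

/-- The wedge `V_t = {s : t ≤ s}`. -/
def Vset (t : T) : Set T := {s | t ≤ s}

/-- Condition (*): every `t` with `cf(t) ≥ ω₁` has finitely many immediate successors. -/
def StarCond (T : Type u) [PartialOrder T] : Prop :=
  ∀ t : T, Cardinal.aleph 1 ≤ cfx t → (ims t).Finite

/-- The coarse wedge topology: generated by the sets `V_t` and their complements,
for `t` minimal or on a successor level. -/
def coarseWedge (T : Type u) [PartialOrder T] : TopologicalSpace T :=
  TopologicalSpace.generateFrom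
    {U : Set T | ∃ t : T, (IsMin t ∨ SuccLevel t) ∧ (U = Vset t ∨ U = (Vset t)ᶜ)}

open Classical in
/-- `s ∧ t = max (ŝ ∩ t̂)`, the largest common predecessor (when it exists). -/
noncomputable def wedge (s t : T) : T :=
  if h : ∃ m, IsGreatest {r : T | r ≤ s ∧ r ≤ t} m then h.choose else s

open Classical in
/-- `ψ(t) = ims(t)` if `cf(t) ≥ ω₁`, and `ψ(t) = {0}` (the root) otherwise. -/
noncomputable def psiSet (root : T) (t : T) : Set T :=
  if Cardinal.aleph 1 ≤ cfx t then ims t else {root}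

/-- `φ` is a choice function assigning to every `t` with `cf(t) = ω` a sequence of
successor-level elements strictly below `t` converging to `t`, and the constant
sequence at the root otherwise. -/
def PhiSpec [TopologicalSpace T] (root : T) (φ : T → ℕ → T) : Prop :=
  ∀ t : T,
    (cfx t ≠ Cardinal.aleph0 → ∀ n, φ t n = root) ∧
    (cfx t = Cardinal.aleph0 →
      (∀ n, φ t n < t ∧ SuccLevel (φ t n)) ∧ Tendsto (φ t) atTop (nhds t))

/-- Membership in the family `𝒜(T)`: countable subsets containing the root, closed
under `∧`, `φ` and `ψ`. -/
structure Admissible (root : T) (φ : T → ℕ → T) (A : Set T) : Prop where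
  countable : A.Countable
  root_mem : root ∈ A
  wedge_mem : ∀ s ∈ A, ∀ t ∈ A, wedge s t ∈ A
  phi_mem : ∀ t ∈ A, ∀ n, φ t n ∈ A
  psi_mem : ∀ t ∈ A, psiSet root t ⊆ A

/-- The height of the tree `T`: the least `α` such that the level `α` of `T` is empty. -/
noncomputable def treeHeight (T : Type u) [PartialOrder T] : Ordinal.{u} :=
  sInf {α : Ordinal | ∀ x : T, htx x ≠ α}

end TreeDefs

/-- A retractional skeleton on a compact space `K`: a family of continuous retractions
with metrizable compact ranges, indexed by an up-directed partially ordered set,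
commuting under the order, continuous under countable increasing suprema, and
converging pointwise to the identity. -/
structure RetractionalSkeleton (K : Type v) [TopologicalSpace K] where
  Γ : Type v
  [po : PartialOrder Γ]
  [ne : Nonempty Γ]
  directed : ∀ s t : Γ, ∃ u, s ≤ u ∧ t ≤ u
  r : Γ → K → K
  cont : ∀ s, Continuous (r s)
  retraction : ∀ s x, r s (r s x) = r s x
  compact_range : ∀ s, IsCompact (Set.range (r s))
  metrizable_range : ∀ s, TopologicalSpace.MetrizableSpace (Set.range (r s))
  comm : ∀ s t : Γ, s ≤ t → ∀ x, r s (r t x) = r s x ∧ r t (r s x) = r s x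
  seq_sup : ∀ s : ℕ → Γ, Monotone s → ∃ t : Γ, IsLUB (Set.range s) t ∧
      ∀ x, Tendsto (fun n => r (s n) x) atTop (nhds (r t x))
  net_conv : ∀ x : K, Tendsto (fun s : Γ => r s x) atTop (nhds x)

/-- The subset induced by a retractional skeleton: `D = ⋃ₛ rₛ[K]`. -/
def RetractionalSkeleton.inducedSet {K : Type v} [TopologicalSpace K]
    (R : RetractionalSkeleton K) : Set K :=
  ⋃ s : R.Γ, Set.range (R.r s)

/-- `A` is a `Σ`-subset of `K`: for some homeomorphic injection `h` of `K` into a cube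
`[0,1]^Γ`, `h(A) = h(K) ∩ Σ(Γ)`. -/
def IsSigmaSubset {K : Type v} [TopologicalSpace K] (A : Set K) : Prop :=
  ∃ (Γ : Type v) (h : K → Γ → Set.Icc (0 : ℝ) 1),
    Topology.IsEmbedding h ∧
      h '' A = Set.range h ∩ {x | {γ | (x γ : ℝ) ≠ 0}.Countable}

/-- `K` is a Valdivia compact space: it has a dense `Σ`-subset. -/
def IsValdivia (K : Type v) [TopologicalSpace K] : Prop :=
  ∃ A : Set K, Dense A ∧ IsSigmaSubset A

/-- The bounded topology on a product `∏_{α<ω₁} X_α`: basic open sets are the sets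
`V(g,β) = {f : f↾β = g↾β}` for `β < ω₁`. -/
def boundedTopology (X : Set.Iio (Cardinal.aleph 1).ord → Type v) :
    TopologicalSpace (∀ α, X α) :=
  TopologicalSpace.generateFrom
    {U | ∃ (g : ∀ α, X α) (β : Ordinal), β < (Cardinal.aleph 1).ord ∧
      U = {f | ∀ α : Set.Iio (Cardinal.aleph 1).ord, (α : Ordinal) < β → f α = g α}}

section TreeOrder

variable {T : Type u} [PartialOrder T]

theorem IsTreeOrder.total_of_lt (h : IsTreeOrder T) {x y z : T} (hy : y < x) (hz : z < x) :
    y ≤ z ∨ z ≤ y := by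
  have := h x
  rcases trichotomous_of (· < ·) (⟨y, hy⟩ : {y : T // y < x}) ⟨z, hz⟩ with h | h | h
  · exact Or.inl (le_of_lt h)
  · exact Or.inl (le_of_eq (congrArg Subtype.val h))
  · exact Or.inr (le_of_lt h)

theorem IsTreeOrder.total (h : IsTreeOrder T) {x y z : T} (hy : y ≤ x) (hz : z ≤ x) :
    y ≤ z ∨ z ≤ y := by
  rcases hy.eq_or_lt with rfl | hy
  · exact Or.inr hz
  rcases hz.eq_or_lt with rfl | hz
  · exact Or.inl hy.le
  exact h.total_of_lt hy hz

theorem IsTreeOrder.isChain_of_subset_Iic (h : IsTreeOrder T) {x : T} {C : Set T}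
    (hC : C ⊆ Iic x) : IsChain (· ≤ ·) C :=
  fun _ hy _ hz _ => h.total (hC hy) (hC hz)

theorem IsTreeOrder.wellFoundedLT (h : IsTreeOrder T) : WellFoundedLT T := by
  refine ⟨⟨fun x => Acc.intro x fun y hy => ?_⟩⟩
  have hw := (h x).toIsWellFounded.wf
  have key : ∀ z : {y : T // y < x}, Acc (· < ·) z.1 := fun z =>
    hw.induction (C := fun z => Acc (· < ·) z.1) z fun z ih =>
      Acc.intro _ fun w hwz => ih ⟨w, hwz.trans z.2⟩ hwz
  exact key ⟨y, hy⟩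

theorem IsTreeOrder.le_of_covBy (h : IsTreeOrder T) {m t y : T} (hm : m ⋖ t) (hy : y < t) :
    y ≤ m := by
  rcases h.total hy.le hm.le with h1 | h1
  · exact h1
  · rcases h1.eq_or_lt with rfl | h1
    · exact le_rfl
    · exact absurd hy (hm.2 h1)

theorem IsTreeOrder.covBy_unique (h : IsTreeOrder T) {m u v x : T} (hu : m ⋖ u) (hv : m ⋖ v)
    (hux : u ≤ x) (hvx : v ≤ x) : u = v := by
  rcases h.total hux hvx with h1 | h1
  · exact h1.eq_of_not_lt fun h2 => hv.2 hu.lt h2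
  · exact (h1.eq_of_not_lt fun h2 => hu.2 hv.lt h2).symm

theorem htx_eq (h : IsTreeOrder T) (x : T) :
    htx x = @Ordinal.type {y : T // y < x} (· < ·) (h x) := by
  simp [htx, h x]

theorem htx_eq_typein (h : IsTreeOrder T) {x y : T} (hy : y < x) :
    htx y = @Ordinal.typein {y : T // y < x} (· < ·) (h x) ⟨y, hy⟩ := by
  have := h x
  have := h y
  rw [htx_eq h]
  let f : PrincipalSeg (α := {z : T // z < y}) (β := {z : T // z < x}) (· < ·) (· < ·) :=
    { toFun := fun z => ⟨z.1, z.2.trans hy⟩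
      inj' := fun a b hab => Subtype.ext (congrArg (fun w => w.1) hab)
      map_rel_iff' := Iff.rfl
      top := ⟨y, hy⟩
      mem_range_iff_rel' := fun b =>
        ⟨by rintro ⟨a, rfl⟩; exact a.2, fun hb => ⟨⟨b.1, hb⟩, rfl⟩⟩ }
  exact (Ordinal.typein_top f).symm

theorem htx_lt (h : IsTreeOrder T) {x y : T} (hy : y < x) : htx y < htx x := by
  have := h x
  rw [htx_eq_typein h hy, htx_eq h x]
  exact Ordinal.typein_lt_type _ _

theorem exists_htx_eq (h : IsTreeOrder T) {x : T} {β : Ordinal} (hβ : β < htx x) :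
    ∃ y < x, htx y = β := by
  have := h x
  rw [htx_eq h x] at hβ
  obtain ⟨⟨y, hy⟩, hyβ⟩ := Ordinal.typein_surj _ hβ
  exact ⟨y, hy, (htx_eq_typein h hy).trans hyβ⟩

theorem covBy_iff_htx (h : IsTreeOrder T) {x y : T} :
    x ⋖ y ↔ x < y ∧ htx y = htx x + 1 := by
  constructor
  · intro hxy
    refine ⟨hxy.lt, le_antisymm ?_ (Order.add_one_le_of_lt (htx_lt h hxy.lt))⟩
    by_contra! hlt
    obtain ⟨z, hzy, hz⟩ := exists_htx_eq h hlt
    rcases (h.le_of_covBy hxy hzy).eq_or_lt with rfl | h1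
    · exact (lt_add_one (htx z)).ne hz
    · exact (htx_lt h h1).not_ge (hz ▸ (lt_add_one (htx x)).le)
  · rintro ⟨hlt, he⟩
    refine ⟨hlt, fun z hxz hzy => ?_⟩
    have h1 := htx_lt h hxz
    have h2 := htx_lt h hzy
    rw [he] at h2
    exact (Order.lt_add_one_iff.1 h2).not_gt h1

theorem mem_ims_iff (h : IsTreeOrder T) {x y : T} : y ∈ ims x ↔ x ⋖ y :=
  (covBy_iff_htx h).symm

theorem succLevel_iff (h : IsTreeOrder T) {t : T} : SuccLevel t ↔ ∃ m, m ⋖ t := by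
  constructor
  · rintro ⟨β, hβ⟩
    obtain ⟨m, hm, rfl⟩ := exists_htx_eq h (hβ ▸ lt_add_one β : β < htx t)
    exact ⟨m, (covBy_iff_htx h).2 ⟨hm, hβ⟩⟩
  · rintro ⟨m, hm⟩
    exact ⟨_, ((covBy_iff_htx h).1 hm).2⟩

/-- The strict predecessors of a point of a tree form a linear order. -/
@[reducible] noncomputable def IsTreeOrder.linearOrder (h : IsTreeOrder T) (x : T) :
    LinearOrder {y : T // y < x} :=
  { (inferInstance : PartialOrder {y : T // y < x}) with
    le_total := fun a b => h.total_of_lt a.2 b.2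
    toDecidableLE := Classical.decRel _ }

theorem cfx_eq_cof (h : IsTreeOrder T) (x : T) : cfx x = Order.cof {y : T // y < x} := by
  let := h.linearOrder x
  have hw := h x
  have : WellFoundedLT {y : T // y < x} := hw.toIsWellFounded
  rw [cfx, htx_eq h]
  exact Ordinal.cof_type {y : T // y < x}

theorem aleph_one_le_cfx_iff (h : IsTreeOrder T) (x : T) :
    aleph 1 ≤ cfx x ↔ ∀ C : Set T, C.Countable → C ⊆ Iio x → ∃ z < x, ∀ y ∈ C, y < z := by
  have hal : ∀ c : Cardinal.{u}, aleph 1 ≤ c ↔ ¬ c ≤ aleph0 := by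
    intro c
    rw [← Cardinal.succ_aleph0, Order.succ_le_iff, not_le]
  rw [cfx_eq_cof h, hal]
  constructor
  · intro hc C hC hCx
    by_contra! hcon
    refine hc ((Order.cof_le (s := Subtype.val ⁻¹' C) fun z => ?_).trans ?_)
    · obtain ⟨y, hyC, hy⟩ := hcon z.1 z.2
      refine ⟨⟨y, hCx hyC⟩, hyC, ?_⟩
      rcases h.total_of_lt (hCx hyC) z.2 with h1 | h1
      · exact (h1.eq_of_not_lt hy).ge
      · exact h1
    · rw [Cardinal.le_aleph0_iff_set_countable]
      exact hC.preimage Subtype.val_injective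
  · intro hC hc
    obtain ⟨s, hs, hsc⟩ := Order.exists_cof_eq {y : T // y < x}
    rw [← hsc, Cardinal.le_aleph0_iff_set_countable] at hc
    obtain ⟨z, hz, hz'⟩ := hC (Subtype.val '' s) (hc.image _) (by rintro _ ⟨a, -, rfl⟩; exact a.2)
    obtain ⟨y, hys, hy⟩ := hs ⟨z, hz⟩
    exact (hz' y.1 ⟨y, hys, rfl⟩).not_ge hy

theorem isLUB_Iio_of_not_covBy (h : IsTreeOrder T) (hcc : ChainComplete T) {x : T}
    (hx : ∀ m, ¬ m ⋖ x) : IsLUB (Iio x) x := by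
  obtain ⟨c, hc⟩ := hcc (Iio x) (h.isChain_of_subset_Iic fun y hy => le_of_lt hy)
  rcases (hc.2 fun y (hy : y < x) => hy.le : c ≤ x).eq_or_lt with rfl | hlt
  · exact hc
  · exact absurd ⟨hlt, fun z hcz hzx => hcz.not_ge (hc.1 hzx)⟩ (hx c)

/-- The index set of the subbase of the coarse wedge topology. -/
def SubbasePoint (t : T) : Prop := IsMin t ∨ SuccLevel t

theorem CovBy.subbasePoint (h : IsTreeOrder T) {m t : T} (hm : m ⋖ t) : SubbasePoint t :=
  Or.inr ((succLevel_iff h).2 ⟨m, hm⟩)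

theorem exists_le_of_isLUB (h : IsTreeOrder T) {C : Set T} (hne : C.Nonempty)
    {c w : T} (hc : IsLUB C c) (hw : SubbasePoint w) (hwc : w ≤ c) : ∃ a ∈ C, w ≤ a := by
  by_contra! hcon
  have hlt : ∀ a ∈ C, a < w := fun a ha => by
    rcases h.total (hc.1 ha) hwc with h1 | h1
    · exact lt_of_le_of_ne h1 fun he => hcon a ha he.ge
    · exact absurd h1 (hcon a ha)
  rcases hw with hw | hw
  · obtain ⟨a, ha⟩ := hne
    exact hw.not_lt (hlt a ha)
  · obtain ⟨m, hm⟩ := (succLevel_iff h).1 hw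
    exact (hm.lt.trans_le hwc).not_ge (hc.2 fun a ha => h.le_of_covBy hm (hlt a ha))

/-- The point where the branch of `a` leaves the branch of `b`. -/
theorem exists_splitting (h : IsTreeOrder T) (hcc : ChainComplete T) {a b : T} (hab : ¬ a ≤ b) :
    ∃ u m, m ⋖ u ∧ u ≤ a ∧ ¬ u ≤ b ∧ ∀ y < u, y ≤ b := by
  have := h.wellFoundedLT
  obtain ⟨u, ⟨hua, hub⟩, hmin⟩ :=
    (wellFounded_lt (α := T)).has_min {y | y ≤ a ∧ ¬ y ≤ b} ⟨a, le_rfl, hab⟩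
  have hlt : ∀ y < u, y ≤ b := fun y hy => by
    by_contra hyb
    exact hmin y ⟨hy.le.trans hua, hyb⟩ hy
  by_cases hm : ∃ m, m ⋖ u
  · obtain ⟨m, hm⟩ := hm
    exact ⟨u, m, hm, hua, hub, hlt⟩
  · exact absurd ((isLUB_Iio_of_not_covBy h hcc (not_exists.1 hm)).2 fun y hy => hlt y hy) hub

theorem exists_splitting_covBy (h : IsTreeOrder T) (hcc : ChainComplete T) {x a : T}
    (hxa : x < a) : ∃ u, x ⋖ u ∧ u ≤ a := by
  obtain ⟨u, m, hm, hua, hux, hlt⟩ := exists_splitting h hcc hxa.not_ge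
  have hxu : x < u := by
    rcases h.total hua hxa.le with h1 | h1
    · exact absurd h1 hux
    · exact lt_of_le_of_ne h1 fun he => hux he.ge
  exact ⟨u, ⟨hxu, fun z hxz hzu => hxz.not_ge (hlt z hzu)⟩, hua⟩

/-- A point of countable cofinality is the supremum of countably many subbase points. -/
theorem exists_seq_isLUB (h : IsTreeOrder T) (hcc : ChainComplete T) {x : T}
    (hx : ¬ aleph 1 ≤ cfx x) :
    ∃ e : ℕ → T, (∀ n, SubbasePoint (e n)) ∧ IsLUB (range e) x := by
  by_cases hB : SubbasePoint x
  · exact ⟨fun _ => x, fun _ => hB, by simp⟩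
  have hlim : ∀ m, ¬ m ⋖ x := fun m hm => hB (hm.subbasePoint h)
  rw [aleph_one_le_cfx_iff h] at hx
  push Not at hx
  obtain ⟨C, hC, hCx, hcof⟩ := hx
  have hne : C.Nonempty := by
    obtain ⟨z, hz⟩ := not_isMin_iff.1 fun hmin => hB (Or.inl hmin)
    obtain ⟨y, hy, -⟩ := hcof z hz
    exact ⟨y, hy⟩
  obtain ⟨f, rfl⟩ := hC.exists_eq_range hne
  have hfx : ∀ n, f n < x := fun n => hCx (mem_range_self n)
  choose e hfe hex using fun n => exists_splitting_covBy h hcc (hfx n)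
  refine ⟨e, fun n => (hfe n).subbasePoint h, ?_, fun b hb => ?_⟩
  · rintro _ ⟨n, rfl⟩
    exact hex n
  · refine (isLUB_Iio_of_not_covBy h hcc hlim).2 fun z hz => ?_
    obtain ⟨_, ⟨n, rfl⟩, hn⟩ := hcof z hz
    have hzf : z ≤ f n := by
      rcases h.total_of_lt (hfx n) hz with h1 | h1
      · exact (h1.eq_of_not_lt hn).ge
      · exact h1
    exact hzf.trans ((hfe n).le.trans (hb (mem_range_self n)))

theorem not_subbasePoint_of_aleph_one_le (h : IsTreeOrder T) {t : T} (ht : aleph 1 ≤ cfx t) :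
    ¬ SubbasePoint t := by
  rw [aleph_one_le_cfx_iff h] at ht
  rintro (hmin | hs)
  · obtain ⟨z, hz, -⟩ := ht ∅ countable_empty (empty_subset _)
    exact hmin.not_lt hz
  · obtain ⟨m, hm⟩ := (succLevel_iff h).1 hs
    obtain ⟨z, hz, hz'⟩ := ht {m} (countable_singleton m) (by simpa using hm.lt)
    exact hm.2 (hz' m rfl) hz

end TreeOrder

section Topology

variable {T : Type u} [PartialOrder T] [TopologicalSpace T]

theorem isClopen_Vset (hτ : ‹TopologicalSpace T› = coarseWedge T) {w : T} (hw : SubbasePoint w) :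
    IsClopen (Vset w) := by
  have hopen : IsOpen (Vset w) ∧ IsOpen (Vset w)ᶜ := by
    rw [hτ]
    exact ⟨TopologicalSpace.isOpen_generateFrom_of_mem ⟨w, hw, Or.inl rfl⟩,
      TopologicalSpace.isOpen_generateFrom_of_mem ⟨w, hw, Or.inr rfl⟩⟩
  exact ⟨⟨hopen.2⟩, hopen.1⟩

theorem tendsto_coarseWedge (hτ : ‹TopologicalSpace T› = coarseWedge T) {ι : Type*} {l : Filter ι}
    {f : ι → T} {x : T} (h1 : ∀ w, SubbasePoint w → w ≤ x → ∀ᶠ i in l, w ≤ f i)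
    (h2 : ∀ w, SubbasePoint w → ¬ w ≤ x → ∀ᶠ i in l, ¬ w ≤ f i) : Tendsto f l (𝓝 x) := by
  subst hτ
  refine TopologicalSpace.tendsto_nhds_generateFrom_iff.2 ?_
  rintro _ ⟨w, hw, rfl | rfl⟩ hx
  · exact h1 w hw hx
  · exact h2 w hw hx

theorem t2Space_coarseWedge (hτ : ‹TopologicalSpace T› = coarseWedge T) (h : IsTreeOrder T)
    (hcc : ChainComplete T) : T2Space T := by
  have key : ∀ x y : T, ¬ x ≤ y → ∃ U V : Set T, IsOpen U ∧ IsOpen V ∧ x ∈ U ∧ y ∈ V ∧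
      Disjoint U V := by
    intro x y hxy
    obtain ⟨u, m, hm, hux, huy, -⟩ := exists_splitting h hcc hxy
    have hc := isClopen_Vset hτ (hm.subbasePoint h)
    exact ⟨Vset u, (Vset u)ᶜ, hc.isOpen, hc.compl.isOpen, hux, huy, disjoint_compl_right⟩
  refine ⟨fun x y hxy => ?_⟩
  by_cases hle : x ≤ y
  · obtain ⟨U, V, hU, hV, hyU, hxV, hd⟩ := key y x fun hyx => hxy (le_antisymm hle hyx)
    exact ⟨V, U, hV, hU, hxV, hyU, hd.symm⟩
  · exact key x y hle

theorem compactSpace_coarseWedge (hτ : ‹TopologicalSpace T› = coarseWedge T) (h : IsTreeOrder T)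
    (hcc : ChainComplete T) {root : T} (hroot : ∀ x, root ≤ x) : CompactSpace T := by
  refine ⟨isCompact_iff_ultrafilter_le_nhds.2 fun F _ => ?_⟩
  obtain ⟨c, hc⟩ := hcc {w | SubbasePoint w ∧ Vset w ∈ F} fun v hv w hw _ => by
    obtain ⟨z, hz⟩ := F.nonempty_of_mem (inter_mem hv.2 hw.2)
    exact h.total hz.1 hz.2
  refine ⟨c, mem_univ c, tendsto_coarseWedge (f := id) hτ (fun w hw hwc => ?_) fun w hw hwc => ?_⟩
  · have hne : {w | SubbasePoint w ∧ Vset w ∈ F}.Nonempty :=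
      ⟨root, Or.inl fun x _ => hroot x, mem_of_superset univ_mem fun x _ => hroot x⟩
    obtain ⟨a, ha, hwa⟩ := exists_le_of_isLUB h hne hc hw hwc
    exact mem_of_superset ha.2 fun z (hz : a ≤ z) => hwa.trans hz
  · exact Ultrafilter.compl_mem_iff_notMem.2 fun hF => hwc (hc.1 ⟨hw, hF⟩)

theorem tendsto_of_monotone_of_isLUB (hτ : ‹TopologicalSpace T› = coarseWedge T)
    (h : IsTreeOrder T) {f : ℕ → T} (hf : Monotone f) {x : T} (hx : IsLUB (range f) x) :
    Tendsto f atTop (𝓝 x) := by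
  refine tendsto_coarseWedge hτ (fun w hw hwx => ?_) fun w _ hwx => ?_
  · obtain ⟨_, ⟨n, rfl⟩, hn⟩ := exists_le_of_isLUB h (range_nonempty f) hx hw hwx
    filter_upwards [eventually_ge_atTop n] with k hk using hn.trans (hf hk)
  · exact Eventually.of_forall fun n hn => hwx (hn.trans (hx.1 (mem_range_self n)))

/-- Points above pairwise distinct immediate successors of `t` converge to `t`. -/
theorem tendsto_of_covBy (hτ : ‹TopologicalSpace T› = coarseWedge T) (h : IsTreeOrder T)
    {t : T} {e d : ℕ → T} (he : Function.Injective e) (hte : ∀ n, t ⋖ e n)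
    (hd : ∀ n, e n ≤ d n) : Tendsto d atTop (𝓝 t) := by
  refine tendsto_coarseWedge hτ (fun w _ hwt => Eventually.of_forall fun n =>
    hwt.trans ((hte n).le.trans (hd n))) fun w _ hwt => ?_
  have hle : ∀ n, w ≤ d n → e n ≤ w := fun n hn => by
    rcases h.total hn (hd n) with h1 | h1
    · rcases h1.eq_or_lt with h2 | h2
      · exact h2.ge
      · exact absurd (h.le_of_covBy (hte n) h2) hwt
    · exact h1
  have hfin : {n | w ≤ d n}.Finite := Set.Subsingleton.finite fun n hn k hk =>
    he (h.covBy_unique (hte n) (hte k) (hle n hn) (hle k hk))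
  rw [← Nat.cofinite_eq_atTop]
  exact hfin.eventually_cofinite_notMem

/-- The branch below a limit point converges to that point. -/
theorem exists_Ico_subset_of_isOpen (hτ : ‹TopologicalSpace T› = coarseWedge T)
    (h : IsTreeOrder T) {t : T} (ht : ¬ SubbasePoint t) {U : Set T} (hU : IsOpen U)
    (htU : t ∈ U) : ∃ y < t, ∀ x, y ≤ x → x < t → x ∈ U := by
  let := h.linearOrder t
  obtain ⟨z, hz⟩ := not_isMin_iff.1 fun hmin => ht (Or.inl hmin)
  have : Nonempty {y : T // y < t} := ⟨⟨z, hz⟩⟩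
  have hlim : Tendsto (fun y : {y : T // y < t} => y.1) atTop (𝓝 t) := by
    refine tendsto_coarseWedge hτ (fun w hw hwt => ?_) fun w _ hwt =>
      Eventually.of_forall fun y hwy => hwt (hwy.trans y.2.le)
    have hlt : w < t := lt_of_le_of_ne hwt fun he => ht (he ▸ hw)
    filter_upwards [eventually_ge_atTop (⟨w, hlt⟩ : {y : T // y < t})] with y hy using hy
  obtain ⟨y, hy⟩ := eventually_atTop.1 (hlim.eventually (hU.mem_nhds htU))
  exact ⟨y.1, y.2, fun x hyx hxt => hy ⟨x, hxt⟩ hyx⟩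

theorem exists_Ico_subset_of_isGδ (hτ : ‹TopologicalSpace T› = coarseWedge T)
    (h : IsTreeOrder T) {t : T} (ht : aleph 1 ≤ cfx t) {G : Set T} (hG : IsGδ G)
    (htG : t ∈ G) : ∃ y < t, ∀ x, y ≤ x → x < t → x ∈ G := by
  obtain ⟨U, hU, rfl⟩ := isGδ_iff_eq_iInter_nat.1 hG
  choose y hyt hy using fun n => exists_Ico_subset_of_isOpen hτ h
    (not_subbasePoint_of_aleph_one_le h ht) (hU n) (mem_iInter.1 htG n)
  obtain ⟨z, hz, hyz⟩ := (aleph_one_le_cfx_iff h t).1 ht (range y) (countable_range y)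
    (by rintro _ ⟨n, rfl⟩; exact hyt n)
  exact ⟨z, hz, fun x hzx hxt => mem_iInter.2 fun n =>
    hy n x ((hyz _ (mem_range_self n)).le.trans hzx) hxt⟩

end Topology

theorem exists_monotone_seq_ge {α : Type*} [Preorder α]
    (hdir : ∀ a b : α, ∃ c, a ≤ c ∧ b ≤ c) (σ : ℕ → α) :
    ∃ s : ℕ → α, Monotone s ∧ ∀ n, σ n ≤ s n := by
  choose c hc1 hc2 using hdir
  let s : ℕ → α := fun n => Nat.rec (σ 0) (fun n a => c a (σ (n + 1))) n
  refine ⟨s, monotone_nat_of_le_succ fun n => hc1 (s n) _, fun n => ?_⟩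
  cases n with
  | zero => exact le_rfl
  | succ n => exact hc2 (s n) _

namespace RetractionalSkeleton

variable {K : Type v} [TopologicalSpace K]

instance (R : RetractionalSkeleton K) : PartialOrder R.Γ := R.po

instance (R : RetractionalSkeleton K) : Nonempty R.Γ := R.ne

instance (R : RetractionalSkeleton K) : IsDirectedOrder R.Γ := ⟨R.directed⟩

theorem eventually_mem (R : RetractionalSkeleton K) {U : Set K} (hU : IsOpen U) {x : K}
    (hx : x ∈ U) : ∃ s₀, ∀ s, s₀ ≤ s → R.r s x ∈ U :=
  eventually_atTop.1 ((R.net_conv x).eventually (hU.mem_nhds hx))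

theorem fixed_mono (R : RetractionalSkeleton K) {s s' : R.Γ} (hs : s ≤ s') {t : K}
    (ht : R.r s t = t) : R.r s' t = t := by
  have := (R.comm s s' hs t).2
  rwa [ht] at this

theorem isGδ_fiber [T2Space K] (R : RetractionalSkeleton K) {s : R.Γ} {t : K}
    (ht : R.r s t = t) : IsGδ {x | R.r s x = t} := by
  have := R.metrizable_range s
  have hc : Continuous (Set.rangeFactorization (R.r s)) := (R.cont s).subtype_mk _
  have hG : IsGδ ({⟨t, t, ht⟩} : Set (range (R.r s))) := IsGδ.singleton _
  convert hG.preimage hc using 1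
  ext x
  simp [Set.rangeFactorization, Subtype.ext_iff]

variable {T : Type u} [PartialOrder T] [TopologicalSpace T]

/-- A point with infinitely many immediate successors is fixed by some retraction. -/
theorem exists_fixed_of_infinite (R : RetractionalSkeleton T)
    (hτ : ‹TopologicalSpace T› = coarseWedge T) (h : IsTreeOrder T) [T2Space T] {t : T}
    (hinf : (ims t).Infinite) : ∃ s, R.r s t = t := by
  let e := hinf.natEmbedding
  have hcov : ∀ n, t ⋖ (e n : T) := fun n => (mem_ims_iff h).1 (e n).2
  have hinj : Function.Injective fun n => (e n : T) := Subtype.val_injective.comp e.injective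
  choose σ hσ using fun n => R.eventually_mem
    (isClopen_Vset hτ ((hcov n).subbasePoint h)).isOpen (show (e n : T) ∈ Vset (e n : T) from le_rfl)
  obtain ⟨s, hs, hσs⟩ := exists_monotone_seq_ge R.directed σ
  obtain ⟨q, hq, -⟩ := R.seq_sup s hs
  refine ⟨q, tendsto_nhds_unique (((R.cont q).tendsto t).comp
    (tendsto_of_covBy hτ h hinj hcov fun _ => le_rfl)) ?_⟩
  exact tendsto_of_covBy hτ h hinj hcov fun n =>
    hσ n q ((hσs n).trans (hq.1 (mem_range_self n)))

/-- A point of uncountable cofinality is not fixed by any retraction. -/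
theorem ne_of_aleph_one_le (R : RetractionalSkeleton T)
    (hτ : ‹TopologicalSpace T› = coarseWedge T) (h : IsTreeOrder T) (hcc : ChainComplete T)
    [T2Space T] {t : T} (ht : aleph 1 ≤ cfx t) (s₀ : R.Γ) : R.r s₀ t ≠ t := by
  intro hs₀
  have hfib : ∀ s, s₀ ≤ s → ∃ y < t, ∀ x, y ≤ x → x < t → R.r s x = t := fun s hs =>
    exists_Ico_subset_of_isGδ hτ h ht (R.isGδ_fiber (R.fixed_mono hs hs₀)) (R.fixed_mono hs hs₀)
  have hub := (aleph_one_le_cfx_iff h t).1 ht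
  let P := {p : R.Γ × T // s₀ ≤ p.1 ∧ p.2 < t ∧ ∀ x, p.2 ≤ x → x < t → R.r p.1 x = t}
  have hstep : ∀ p : P, ∃ q : P, p.1.1 ≤ q.1.1 ∧ ∃ v, p.1.2 < v ∧ v ≤ q.1.2 ∧
      ∀ s, q.1.1 ≤ s → ¬ v ≤ R.r s p.1.2 := by
    rintro ⟨⟨s, x⟩, hs, hx, -⟩
    obtain ⟨v, hv, hvt⟩ := exists_splitting_covBy h hcc hx
    have hvB := hv.subbasePoint h
    have hvlt : v < t := lt_of_le_of_ne hvt fun he =>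
      not_subbasePoint_of_aleph_one_le h ht (he ▸ hvB)
    obtain ⟨s₁, hs₁⟩ := R.eventually_mem (isClopen_Vset hτ hvB).compl.isOpen
      (show x ∈ (Vset v)ᶜ from hv.lt.not_ge)
    obtain ⟨s₂, h02, h12⟩ := R.directed s s₁
    obtain ⟨y, hy, hyt⟩ := hfib s₂ (hs.trans h02)
    obtain ⟨z, hz, hz'⟩ := hub {v, y} (by simp) (by rintro _ (rfl | rfl) <;> assumption)
    exact ⟨⟨⟨s₂, z⟩, hs.trans h02, hz, fun x hx => hyt x ((hz' y (by simp)).le.trans hx)⟩, h02,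
      v, hv.lt, (hz' v (by simp)).le, fun s hs => hs₁ s (h12.trans hs)⟩
  choose next hnext v hpv hvn hv using hstep
  obtain ⟨y₀, hy₀, hy₀t⟩ := hfib s₀ le_rfl
  let p : ℕ → P := fun n => Nat.rec ⟨⟨s₀, y₀⟩, le_rfl, hy₀, hy₀t⟩ (fun _ q => next q) n
  have hsm : Monotone fun n => (p n).1.1 := monotone_nat_of_le_succ fun n => hnext (p n)
  have hxm : Monotone fun n => (p n).1.2 := monotone_nat_of_le_succ fun n =>
    (hpv (p n)).le.trans (hvn (p n))
  obtain ⟨q, hq, hqlim⟩ := R.seq_sup _ hsm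
  obtain ⟨z, hz, hz'⟩ := hub (range fun n => (p n).1.2) (countable_range _)
    (by rintro _ ⟨n, rfl⟩; exact (p n).2.2.1)
  obtain ⟨x, hx⟩ := hcc (range fun n => (p n).1.2) (h.isChain_of_subset_Iic (x := z)
    fun y hy => (hz' y hy).le)
  have hxt : x < t := (hx.2 fun y hy => (hz' y hy).le).trans_lt hz
  have hqx : R.r q x = t := by
    refine tendsto_nhds_unique (hqlim x) (tendsto_const_nhds.congr fun n => ?_)
    exact ((p n).2.2.2 x (hx.1 (mem_range_self n)) hxt).symm
  obtain ⟨w, hw, hwt⟩ := exists_splitting_covBy h hcc hxt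
  have hev : ∀ᶠ n in atTop, R.r q (p n).1.2 ∈ Vset w :=
    (((R.cont q).tendsto x).comp (tendsto_of_monotone_of_isLUB hτ h hxm hx)).eventually
      ((isClopen_Vset hτ (hw.subbasePoint h)).isOpen.mem_nhds (by rw [hqx]; exact hwt))
  obtain ⟨n, hn⟩ := hev.exists
  refine hv (p n) q (hq.1 (mem_range_self (n + 1))) (le_trans ?_ hn)
  exact (hvn (p n)).trans ((hx.1 (mem_range_self (n + 1))).trans hw.le)

theorem starCond (R : RetractionalSkeleton T) (hτ : ‹TopologicalSpace T› = coarseWedge T)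
    (h : IsTreeOrder T) (hcc : ChainComplete T) : StarCond T := by
  have := t2Space_coarseWedge hτ h hcc
  intro t ht
  by_contra hinf
  obtain ⟨s, hs⟩ := R.exists_fixed_of_infinite hτ h hinf
  exact R.ne_of_aleph_one_le hτ h hcc ht s hs

end RetractionalSkeleton

theorem exists_countable_closed {α : Type*} {F : α → α → Set α} (hF : ∀ a b, (F a b).Countable)
    {A₀ S : Set α} (hA₀ : A₀.Countable) (hAS : A₀ ⊆ S) (hFS : ∀ a b, F a b ⊆ S) :
    ∃ A, A₀ ⊆ A ∧ A.Countable ∧ A ⊆ S ∧ ∀ a ∈ A, ∀ b ∈ A, F a b ⊆ A := by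
  let step : Set α → Set α := fun A => A ∪ ⋃ a ∈ A, ⋃ b ∈ A, F a b
  let s : ℕ → Set α := fun n => step^[n] A₀
  have hsucc : ∀ n, s (n + 1) = step (s n) := fun n => Function.iterate_succ_apply' step n A₀
  have hmono : Monotone s := monotone_nat_of_le_succ fun n => by
    rw [hsucc]; exact subset_union_left
  have hcount : ∀ n, (s n).Countable := fun n => by
    induction n with
    | zero => exact hA₀
    | succ n ih =>
      rw [hsucc]
      exact ih.union (ih.biUnion fun a _ => ih.biUnion fun b _ => hF a b)
  have hS : ∀ n, s n ⊆ S := fun n => by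
    induction n with
    | zero => exact hAS
    | succ n ih =>
      rw [hsucc]
      exact union_subset ih (iUnion₂_subset fun a _ => iUnion₂_subset fun b _ => hFS a b)
  refine ⟨⋃ n, s n, subset_iUnion s 0, countable_iUnion hcount, iUnion_subset hS, ?_⟩
  intro a ha b hb
  obtain ⟨i, hi⟩ := mem_iUnion.1 ha
  obtain ⟨j, hj⟩ := mem_iUnion.1 hb
  refine Subset.trans ?_ (subset_iUnion s (max i j + 1))
  rw [hsucc]
  exact Subset.trans (subset_biUnion_of_mem (u := fun b => F a b) (hmono (le_max_right i j) hj))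
    ((subset_biUnion_of_mem (u := fun a => ⋃ b ∈ s (max i j), F a b)
      (hmono (le_max_left i j) hi)).trans subset_union_right)

section Skeleton

variable {T : Type u} [PartialOrder T]

/-- `u` is the first point of the branch of `a` that is not on the branch of `b`. -/
def IsSplitting (u a b : T) : Prop := u ≤ a ∧ ¬ u ≤ b ∧ ∀ y < u, y ≤ b

theorem IsSplitting.unique (h : IsTreeOrder T) {u v a b : T} (hu : IsSplitting u a b)
    (hv : IsSplitting v a b) : u = v := by
  rcases h.total hu.1 hv.1 with h1 | h1
  · exact h1.eq_of_not_lt fun h2 => hu.2.1 (hv.2.2 u h2)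
  · exact (h1.eq_of_not_lt fun h2 => hv.2.1 (hu.2.2 v h2)).symm

theorem IsSplitting.subbasePoint (h : IsTreeOrder T) (hcc : ChainComplete T) {u a b : T}
    (hu : IsSplitting u a b) : SubbasePoint u := by
  obtain ⟨v, m, hm, hv⟩ := exists_splitting h hcc (fun hab => hu.2.1 (hu.1.trans hab))
  exact hu.unique h hv ▸ hm.subbasePoint h

/-- The countable sets of subbase points that index the retractional skeleton. -/
structure IsRich (root : T) (A : Set T) : Prop where
  countable : A.Countable
  subbasePoint : ∀ a ∈ A, SubbasePoint a
  root_mem : root ∈ A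
  splitting_mem : ∀ a ∈ A, ∀ b ∈ A, ∀ u, IsSplitting u a b → u ∈ A
  isLUB : ∀ u ∈ A, ∀ m, m ⋖ u → ¬ aleph 1 ≤ cfx m → IsLUB (A ∩ Iic m) m

theorem IsRich.inter_Iic_nonempty {root : T} {A : Set T} (hA : IsRich root A) (hroot : ∀ x, root ≤ x)
    (x : T) : (A ∩ Iic x).Nonempty :=
  ⟨root, hA.root_mem, hroot x⟩

theorem exists_isRich_superset (h : IsTreeOrder T) (hcc : ChainComplete T) {root : T}
    (hroot : ∀ x, root ≤ x) {A₀ : Set T} (hA₀ : A₀.Countable)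
    (hsub : ∀ a ∈ A₀, SubbasePoint a) : ∃ A, A₀ ⊆ A ∧ IsRich root A := by
  have hrB : SubbasePoint root := Or.inl fun x _ => hroot x
  have hex : ∀ m : T, ∃ e : ℕ → T, (∀ n, SubbasePoint (e n)) ∧
      (¬ aleph 1 ≤ cfx m → IsLUB (range e) m) := fun m => by
    by_cases hm : aleph 1 ≤ cfx m
    · exact ⟨fun _ => root, fun _ => hrB, fun hn => absurd hm hn⟩
    · obtain ⟨e, he, hl⟩ := exists_seq_isLUB h hcc hm
      exact ⟨e, he, fun _ => hl⟩
  choose e heB heL using hex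
  obtain ⟨A, hA₀A, hAc, hAS, hA⟩ := exists_countable_closed
    (F := fun a b => {u | IsSplitting u a b} ∪ ⋃ m ∈ {m | m ⋖ a}, range (e m))
    (A₀ := insert root A₀) (S := {t | SubbasePoint t})
    (fun a b => by
      refine Countable.union (Subsingleton.countable fun u hu v hv => hu.unique h hv)
        (Countable.biUnion (Subsingleton.countable fun m hm n hn => ?_)
          fun m _ => countable_range (e m))
      exact le_antisymm (h.le_of_covBy hn hm.lt) (h.le_of_covBy hm hn.lt))
    (hA₀.insert root) (insert_subset hrB hsub)
    (fun a b => union_subset (fun u hu => hu.subbasePoint h hcc)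
      (iUnion₂_subset fun m _ => range_subset_iff.2 (heB m)))
  refine ⟨A, (subset_insert _ _).trans hA₀A, hAc, hAS, hA₀A (mem_insert _ _),
    fun a ha b hb u hu => hA a ha b hb (Or.inl hu), fun u hu m hm hcf => ?_⟩
  refine ⟨fun y hy => hy.2, fun b hb => (heL m hcf).2 ?_⟩
  rintro _ ⟨n, rfl⟩
  exact hb ⟨hA u hu u hu (Or.inr (mem_biUnion (show m ∈ {m | m ⋖ u} from hm)
    (mem_range_self n))), (heL m hcf).1 (mem_range_self n)⟩

theorem isRich_iUnion {root : T} {s : ℕ → Set T} (hs : Monotone s) (hr : ∀ n, IsRich root (s n)) :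
    IsRich root (⋃ n, s n) where
  countable := countable_iUnion fun n => (hr n).countable
  subbasePoint a ha := by
    obtain ⟨n, hn⟩ := mem_iUnion.1 ha
    exact (hr n).subbasePoint a hn
  root_mem := mem_iUnion.2 ⟨0, (hr 0).root_mem⟩
  splitting_mem a ha b hb u hu := by
    obtain ⟨i, hi⟩ := mem_iUnion.1 ha
    obtain ⟨j, hj⟩ := mem_iUnion.1 hb
    exact mem_iUnion.2 ⟨max i j, (hr _).splitting_mem a (hs (le_max_left i j) hi) b
      (hs (le_max_right i j) hj) u hu⟩
  isLUB u hu m hm hcf := by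
    obtain ⟨n, hn⟩ := mem_iUnion.1 hu
    exact ⟨fun y hy => hy.2, fun b hb => ((hr n).isLUB u hn m hm hcf).2 fun y hy =>
      hb ⟨mem_iUnion.2 ⟨n, hy.1⟩, hy.2⟩⟩

/-- The supremum of the part of the branch of `x` that lies in `A`. -/
noncomputable def branchSup (h : IsTreeOrder T) (hcc : ChainComplete T) (A : Set T) (x : T) : T :=
  (hcc (A ∩ Iic x) (h.isChain_of_subset_Iic inter_subset_right)).choose

theorem isLUB_branchSup (h : IsTreeOrder T) (hcc : ChainComplete T) (A : Set T) (x : T) :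
    IsLUB (A ∩ Iic x) (branchSup h hcc A x) :=
  (hcc (A ∩ Iic x) (h.isChain_of_subset_Iic inter_subset_right)).choose_spec

theorem branchSup_le (h : IsTreeOrder T) (hcc : ChainComplete T) (A : Set T) (x : T) :
    branchSup h hcc A x ≤ x :=
  (isLUB_branchSup h hcc A x).2 fun _ hy => hy.2

theorem le_branchSup_iff (h : IsTreeOrder T) (hcc : ChainComplete T) {A : Set T} {a x : T}
    (ha : a ∈ A) : a ≤ branchSup h hcc A x ↔ a ≤ x :=
  ⟨fun hax => hax.trans (branchSup_le h hcc A x),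
    fun hax => (isLUB_branchSup h hcc A x).1 ⟨ha, hax⟩⟩

theorem branchSup_eq_of_forall (h : IsTreeOrder T) (hcc : ChainComplete T) {A : Set T} {x y : T}
    (hxy : ∀ a ∈ A, a ≤ x ↔ a ≤ y) : branchSup h hcc A x = branchSup h hcc A y := by
  have : A ∩ Iic x = A ∩ Iic y := by
    ext a
    exact and_congr_right fun ha => hxy a ha
  refine (isLUB_branchSup h hcc A x).unique ?_
  rw [this]
  exact isLUB_branchSup h hcc A y

theorem branchSup_branchSup_of_subset (h : IsTreeOrder T) (hcc : ChainComplete T) {A B : Set T}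
    (hAB : A ⊆ B) (x : T) : branchSup h hcc A (branchSup h hcc B x) = branchSup h hcc A x :=
  branchSup_eq_of_forall h hcc fun _ ha => le_branchSup_iff h hcc (hAB ha)

theorem branchSup_branchSup_of_superset (h : IsTreeOrder T) (hcc : ChainComplete T) {A B : Set T}
    (hAB : A ⊆ B) (x : T) : branchSup h hcc B (branchSup h hcc A x) = branchSup h hcc A x :=
  le_antisymm (branchSup_le h hcc B _) ((isLUB_branchSup h hcc A x).2 fun _ ha =>
    (le_branchSup_iff h hcc (hAB ha.1)).2 ((isLUB_branchSup h hcc A x).1 ha))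

theorem le_branchSup_iff_exists (h : IsTreeOrder T) (hcc : ChainComplete T) {root : T}
    (hroot : ∀ x, root ≤ x) {A : Set T} (hA : IsRich root A) {w x : T} (hw : SubbasePoint w) :
    w ≤ branchSup h hcc A x ↔ ∃ a ∈ A, w ≤ a ∧ a ≤ x := by
  constructor
  · intro hwx
    obtain ⟨a, ⟨haA, hax⟩, hwa⟩ := exists_le_of_isLUB h (hA.inter_Iic_nonempty hroot x)
      (isLUB_branchSup h hcc A x) hw hwx
    exact ⟨a, haA, hwa, hax⟩
  · rintro ⟨a, haA, hwa, hax⟩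
    exact hwa.trans ((le_branchSup_iff h hcc haA).2 hax)

variable [TopologicalSpace T]

theorem IsRich.isClosed_iUnion_Vset (hτ : ‹TopologicalSpace T› = coarseWedge T)
    (h : IsTreeOrder T) (hcc : ChainComplete T) (hstar : StarCond T) {root : T}
    (hroot : ∀ x, root ≤ x) {A : Set T} (hA : IsRich root A) {w : T} (hw : SubbasePoint w) :
    IsClosed {x | ∃ a ∈ A, w ≤ a ∧ a ≤ x} := by
  rw [← isOpen_compl_iff, isOpen_iff_mem_nhds]
  intro x hx
  replace hx : ∀ a ∈ A, w ≤ a → ¬ a ≤ x := fun a ha hwa hax => hx ⟨a, ha, hwa, hax⟩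
  by_cases hwx : w ≤ x
  swap
  · refine mem_of_superset ((isClopen_Vset hτ hw).compl.isOpen.mem_nhds hwx) ?_
    rintro z hz ⟨a, -, hwa, haz⟩
    exact hz (hwa.trans haz)
  by_cases hside : ∃ a ∈ A, w ≤ a ∧ ¬ x ≤ a
  · obtain ⟨a, ha, hwa, hxa⟩ := hside
    obtain ⟨v, m, hm, hv⟩ := exists_splitting h hcc hxa
    refine mem_of_superset
      ((isClopen_Vset hτ (hm.subbasePoint h)).isOpen.mem_nhds (show v ≤ x from hv.1)) ?_
    rintro z (hvz : v ≤ z) ⟨b, hb, hwb, hbz⟩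
    rcases h.total hvz hbz with h1 | h1
    · have hwv : w ≤ v := by
        rcases h.total hwx hv.1 with h2 | h2
        · exact h2
        · exact absurd (h2.trans hwa) hv.2.1
      exact hx v (hA.splitting_mem b hb a ha v ⟨h1, hv.2⟩) hwv hv.1
    · exact hx b hb hwb (h1.trans hv.1)
  push Not at hside
  have hlt : ∀ a ∈ A, w ≤ a → x < a := fun a ha hwa =>
    lt_of_le_of_ne (hside a ha hwa) fun he => hx a ha hwa he.ge
  have hfin : {u | x ⋖ u ∧ ∃ a ∈ A, w ≤ a ∧ u ≤ a}.Finite := by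
    by_cases hcf : aleph 1 ≤ cfx x
    · exact (hstar x hcf).subset fun u hu => (mem_ims_iff h).2 hu.1
    · refine Set.Subsingleton.finite ?_
      rintro u ⟨hxu, a, ha, hwa, hua⟩ v ⟨hxv, b, hb, hwb, hvb⟩
      by_contra huv
      have hu : u ∈ A := hA.splitting_mem a ha b hb u
        ⟨hua, fun hub => huv (h.covBy_unique hxu hxv hub hvb),
          fun y hy => (h.le_of_covBy hxu hy).trans (hside b hb hwb)⟩
      obtain ⟨c, hc, hwc⟩ := exists_le_of_isLUB h (hA.inter_Iic_nonempty hroot x)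
        (hA.isLUB u hu x hxu hcf) hw hwx
      exact hx c hc.1 hwc hc.2
  have hclosed : IsClosed (⋃ u ∈ {u | x ⋖ u ∧ ∃ a ∈ A, w ≤ a ∧ u ≤ a}, Vset u) :=
    hfin.isClosed_biUnion fun u hu => (isClopen_Vset hτ (hu.1.subbasePoint h)).isClosed
  refine mem_of_superset (hclosed.isOpen_compl.mem_nhds fun hmem => ?_) ?_
  · obtain ⟨u, hu, hux⟩ := mem_iUnion₂.1 hmem
    exact hu.1.lt.not_ge hux
  · rintro z hz ⟨a, ha, hwa, haz⟩
    obtain ⟨u, hxu, hua⟩ := exists_splitting_covBy h hcc (hlt a ha hwa)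
    exact hz (mem_iUnion₂.2 ⟨u, ⟨hxu, a, ha, hwa, hua⟩, hua.trans haz⟩)

theorem IsRich.continuous_branchSup (hτ : ‹TopologicalSpace T› = coarseWedge T)
    (h : IsTreeOrder T) (hcc : ChainComplete T) (hstar : StarCond T) {root : T}
    (hroot : ∀ x, root ≤ x) {A : Set T} (hA : IsRich root A) :
    Continuous (branchSup h hcc A) := by
  have key : ∀ w, SubbasePoint w → IsClopen {x | w ≤ branchSup h hcc A x} := by
    intro w hw
    simp only [le_branchSup_iff_exists h hcc hroot hA hw]
    refine ⟨hA.isClosed_iUnion_Vset hτ h hcc hstar hroot hw, ?_⟩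
    have : {x | ∃ a ∈ A, w ≤ a ∧ a ≤ x} = ⋃ a ∈ {a ∈ A | w ≤ a}, Vset a := by
      ext x
      simp [Vset, and_assoc]
    rw [this]
    exact isOpen_biUnion fun a ha => (isClopen_Vset hτ (hA.subbasePoint a ha.1)).isOpen
  refine continuous_iff_continuousAt.2 fun x => tendsto_coarseWedge hτ ?_ ?_
  · exact fun w hw hwx => (key w hw).isOpen.mem_nhds hwx
  · exact fun w hw hwx => (key w hw).compl.isOpen.mem_nhds hwx

theorem IsRich.metrizableSpace_range (hτ : ‹TopologicalSpace T› = coarseWedge T)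
    (h : IsTreeOrder T) (hcc : ChainComplete T) {root : T} {A : Set T} (hA : IsRich root A)
    (hK : IsCompact (range (branchSup h hcc A))) :
    TopologicalSpace.MetrizableSpace (range (branchSup h hcc A)) := by
  classical
  have := hA.countable.to_subtype
  have := isCompact_iff_compactSpace.1 hK
  let f : range (branchSup h hcc A) → A → Bool := fun y a => decide ((a : T) ≤ y)
  have hf : Continuous f := continuous_pi fun a => by
    have hc := (isClopen_Vset hτ (hA.subbasePoint a a.2)).preimage
      (continuous_subtype_val (p := (· ∈ range (branchSup h hcc A))))
    refine (continuous_bool_rng true).2 ?_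
    convert hc using 1
    ext y
    simp [f, Vset]
  have hinj : Function.Injective f := by
    rintro ⟨_, x, rfl⟩ ⟨_, y, rfl⟩ hxy
    refine Subtype.ext (branchSup_eq_of_forall h hcc fun a ha => ?_)
    have := congrFun hxy ⟨a, ha⟩
    simpa [f, le_branchSup_iff h hcc ha] using this
  exact (hf.isClosedEmbedding hinj).isEmbedding.metrizableSpace

/-- The retractional skeleton of a tree with finitely many immediate successors at points of
uncountable cofinality. -/
noncomputable def StarCond.retractionalSkeleton (hτ : ‹TopologicalSpace T› = coarseWedge T)
    (h : IsTreeOrder T) (hcc : ChainComplete T) (hstar : StarCond T) {root : T}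
    (hroot : ∀ x, root ≤ x) : RetractionalSkeleton T :=
  have := compactSpace_coarseWedge hτ h hcc hroot
  have hcont := fun A : {A // IsRich root A} => A.2.continuous_branchSup hτ h hcc hstar hroot
  { Γ := {A // IsRich root A}
    ne := by
      obtain ⟨A, -, hA⟩ := exists_isRich_superset h hcc hroot countable_empty (by simp)
      exact ⟨A, hA⟩
    directed := fun A B => by
      obtain ⟨C, hC, hCr⟩ := exists_isRich_superset h hcc hroot
        (A.2.countable.union B.2.countable)
        (by rintro a (ha | ha); exacts [A.2.subbasePoint a ha, B.2.subbasePoint a ha])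
      exact ⟨⟨C, hCr⟩, subset_union_left.trans hC, subset_union_right.trans hC⟩
    r := fun A => branchSup h hcc A
    cont := hcont
    retraction := fun _ => branchSup_branchSup_of_subset h hcc Subset.rfl
    compact_range := fun A => isCompact_range (hcont A)
    metrizable_range := fun A =>
      A.2.metrizableSpace_range hτ h hcc (isCompact_range (hcont A))
    comm := fun _ _ hAB x =>
      ⟨branchSup_branchSup_of_subset h hcc hAB x, branchSup_branchSup_of_superset h hcc hAB x⟩
    seq_sup := fun s hs => by
      have hU : IsRich root (⋃ n, (s n : Set T)) :=
        isRich_iUnion (fun _ _ hij => hs hij) fun n => (s n).2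
      refine ⟨⟨_, hU⟩, ⟨?_, fun B hB => iUnion_subset fun n => hB (mem_range_self n)⟩,
        fun x => tendsto_coarseWedge hτ (fun w hw hwx => ?_) fun w hw hwx => ?_⟩
      · rintro _ ⟨n, rfl⟩
        exact subset_iUnion (fun n => (s n : Set T)) n
      · obtain ⟨a, ha, hwa, hax⟩ := (le_branchSup_iff_exists h hcc hroot hU hw).1 hwx
        obtain ⟨n, hn⟩ := mem_iUnion.1 ha
        filter_upwards [eventually_ge_atTop n] with k hk
        exact hwa.trans ((le_branchSup_iff h hcc (hs hk hn)).2 hax)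
      · refine Eventually.of_forall fun n hwn => hwx ?_
        obtain ⟨a, ha, hwa, hax⟩ := (le_branchSup_iff_exists h hcc hroot (s n).2 hw).1 hwn
        exact hwa.trans ((le_branchSup_iff h hcc (mem_iUnion.2 ⟨n, ha⟩)).2 hax)
    net_conv := fun x => by
      refine tendsto_coarseWedge hτ (fun w hw hwx => ?_) fun w _ hwx =>
        Eventually.of_forall fun A hwA => hwx (hwA.trans (branchSup_le h hcc A x))
      obtain ⟨A, hwA, hA⟩ := exists_isRich_superset h hcc hroot (countable_singleton w)
        (by simpa using hw)
      filter_upwards [eventually_ge_atTop (⟨A, hA⟩ : {A // IsRich root A})] with B hB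
      exact (le_branchSup_iff h hcc (hB (hwA rfl))).2 hwx }

end Skeleton

theorem stmt0 {T : Type u} [PartialOrder T] [τ : TopologicalSpace T]
    (hτ : τ = coarseWedge T) (htree : IsTreeOrder T) (hcc : ChainComplete T)
    (root : T) (hroot : ∀ x : T, root ≤ x) :
    Nonempty (RetractionalSkeleton T) ↔ StarCond T :=
  ⟨fun ⟨R⟩ => R.starCond hτ htree hcc,
    fun hstar => ⟨hstar.retractionalSkeleton hτ htree hcc hroot⟩⟩
end

section
/- Let T be a rooted chain complete tree satisfying condition (*), and let S be a countable subset of T. Then there exists A ∈ 𝒜(T) such that S ⊆ A. -/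
open Cardinal Ordinal Filter Set Topology

universe u v

/-- A countable set is contained in a countable set closed under a binary operation and a
countable-set-valued map. -/
theorem exists_countable_closed_superset {α : Type u} (op : α → α → α) (F : α → Set α)
    (hF : ∀ a, (F a).Countable) {S : Set α} (hS : S.Countable) :
    ∃ A : Set α, A.Countable ∧ S ⊆ A ∧ (∀ s ∈ A, ∀ t ∈ A, op s t ∈ A) ∧ ∀ t ∈ A, F t ⊆ A := by
  let step : Set α → Set α := fun A => A ∪ Set.image2 op A A ∪ ⋃ t ∈ A, F t
  let stage : ℕ → Set α := fun n => step^[n] S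
  have stage_succ (n : ℕ) : stage (n + 1) = step (stage n) :=
    Function.iterate_succ_apply' step n S
  have hmono : Monotone stage := monotone_nat_of_le_succ fun n x hx => by
    rw [stage_succ]
    exact Or.inl (Or.inl hx)
  have hcount (n : ℕ) : (stage n).Countable := by
    induction n with
    | zero => exact hS
    | succ n ih =>
      rw [stage_succ]
      exact (ih.union (ih.image2 ih op)).union (ih.biUnion fun t _ => hF t)
  refine ⟨⋃ n, stage n, Set.countable_iUnion hcount, Set.subset_iUnion stage 0, ?_, ?_⟩
  · intro s hs t ht
    obtain ⟨m, hm⟩ := Set.mem_iUnion.1 hs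
    obtain ⟨n, hn⟩ := Set.mem_iUnion.1 ht
    refine Set.mem_iUnion.2 ⟨max m n + 1, ?_⟩
    rw [stage_succ]
    exact Or.inl (Or.inr (Set.mem_image2_of_mem
      (hmono (le_max_left m n) hm) (hmono (le_max_right m n) hn)))
  · intro t ht x hx
    obtain ⟨n, hn⟩ := Set.mem_iUnion.1 ht
    refine Set.mem_iUnion.2 ⟨n + 1, ?_⟩
    rw [stage_succ]
    exact Or.inr (Set.mem_biUnion hn hx)

/-- Under condition (*), every value of `ψ` is finite. -/
theorem StarCond.finite_psiSet {T : Type u} [PartialOrder T] (hstar : StarCond T) (root t : T) :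
    (psiSet root t).Finite := by
  unfold psiSet
  split_ifs with h
  · exact hstar t h
  · exact Set.finite_singleton root

theorem stmt2 {T : Type u} [PartialOrder T] [τ : TopologicalSpace T]
    (hτ : τ = coarseWedge T) (htree : IsTreeOrder T) (hcc : ChainComplete T)
    (root : T) (hroot : ∀ x : T, root ≤ x)
    (hstar : StarCond T) (φ : T → ℕ → T) (hφ : PhiSpec root φ)
    (S : Set T) (hS : S.Countable) :
    ∃ A : Set T, Admissible root φ A ∧ S ⊆ A := by
  obtain ⟨A, hA, hSA, hwedge, hclosed⟩ := exists_countable_closed_superset wedge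
    (fun t => Set.range (φ t) ∪ psiSet root t)
    (fun t => (Set.countable_range _).union (hstar.finite_psiSet root t).countable)
    (hS.insert root)
  exact ⟨A, ⟨hA, hSA (Set.mem_insert _ _), hwedge,
    fun t ht n => hclosed t ht (Or.inl (Set.mem_range_self n)),
    fun t ht => Set.subset_union_right.trans (hclosed t ht)⟩,
    (Set.subset_insert _ _).trans hSA⟩
end

section
/- Let T be a rooted chain complete tree satisfying condition (*). Then the family 𝒜(T), ordered by inclusion, is an up-directed partially ordered set, and it is σ-complete: every increasing sequence A₀ ⊆ A₁ ⊆ … of elements of 𝒜(T) has a supremum in 𝒜(T), namely its union. -/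
open Cardinal Ordinal Filter Set Topology

universe u v

section Admissible

variable {T : Type u} [PartialOrder T]

lemma StarCond.psiSet_countable (hstar : StarCond T) (root t : T) :
    (psiSet root t).Countable := by
  unfold psiSet
  split_ifs with h
  · exact (hstar t h).countable
  · exact countable_singleton root

/-- One round of closing off a set under `∧`, `φ` and `ψ`. -/
def admissibleStep (root : T) (φ : T → ℕ → T) (A : Set T) : Set T :=
  A ∪ image2 wedge A A ∪ image2 φ A univ ∪ ⋃ t ∈ A, psiSet root t

lemma admissibleStep_countable (hstar : StarCond T) (root : T) (φ : T → ℕ → T) {A : Set T}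
    (hA : A.Countable) : (admissibleStep root φ A).Countable :=
  ((hA.union (hA.image2 hA _)).union (hA.image2 countable_univ _)).union
    (hA.biUnion fun t _ => hstar.psiSet_countable root t)

/-- The union of an increasing sequence of countable sets containing the root, each of which
contains the result of closing off its predecessors once, is admissible. -/
lemma admissible_iUnion_of_step {root : T} {φ : T → ℕ → T} {A : ℕ → Set T} (hmono : Monotone A)
    (hcount : ∀ n, (A n).Countable) (hroot : root ∈ A 0)
    (hstep : ∀ n, admissibleStep root φ (A n) ⊆ A (n + 1)) :
    Admissible root φ (⋃ n, A n) where
  countable := countable_iUnion hcount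
  root_mem := mem_iUnion.2 ⟨0, hroot⟩
  wedge_mem s hs t ht := by
    obtain ⟨m, hm⟩ := mem_iUnion.1 hs
    obtain ⟨n, hn⟩ := mem_iUnion.1 ht
    refine mem_iUnion.2 ⟨max m n + 1, hstep _ (Or.inl (Or.inl (Or.inr ?_)))⟩
    exact mem_image2_of_mem (hmono (le_max_left m n) hm) (hmono (le_max_right m n) hn)
  phi_mem t ht k := by
    obtain ⟨n, hn⟩ := mem_iUnion.1 ht
    exact mem_iUnion.2 ⟨n + 1, hstep n (Or.inl (Or.inr (mem_image2_of_mem hn (mem_univ k))))⟩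
  psi_mem t ht x hx := by
    obtain ⟨n, hn⟩ := mem_iUnion.1 ht
    exact mem_iUnion.2 ⟨n + 1, hstep n (Or.inr (mem_biUnion hn hx))⟩

lemma Admissible.admissibleStep_subset {root : T} {φ : T → ℕ → T} {A : Set T}
    (hA : Admissible root φ A) : admissibleStep root φ A ⊆ A := by
  refine union_subset (union_subset (union_subset subset_rfl ?_) ?_) (iUnion₂_subset hA.psi_mem)
  · exact image2_subset_iff.2 hA.wedge_mem
  · exact image2_subset_iff.2 fun t ht n _ => hA.phi_mem t ht n

lemma Admissible.iUnion {root : T} {φ : T → ℕ → T} {A : ℕ → Set T}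
    (hA : ∀ n, Admissible root φ (A n)) (hmono : Monotone A) : Admissible root φ (⋃ n, A n) :=
  admissible_iUnion_of_step hmono (fun n => (hA n).countable) (hA 0).root_mem
    fun n => (hA n).admissibleStep_subset.trans (hmono n.le_succ)

/-- Under condition (*), every countable set is contained in an admissible one. -/
lemma StarCond.exists_admissible_superset (hstar : StarCond T) (root : T) (φ : T → ℕ → T)
    {A : Set T} (hA : A.Countable) : ∃ C, Admissible root φ C ∧ A ⊆ C := by
  let S : ℕ → Set T := fun n => (admissibleStep root φ)^[n] (insert root A)
  have hsucc (n : ℕ) : S (n + 1) = admissibleStep root φ (S n) :=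
    Function.iterate_succ_apply' _ _ _
  have hmono : Monotone S := monotone_nat_of_le_succ fun n x hx => by
    rw [hsucc]
    exact Or.inl (Or.inl (Or.inl hx))
  have hcount (n : ℕ) : (S n).Countable := by
    induction n with
    | zero => exact hA.insert root
    | succ n ih =>
      rw [hsucc]
      exact admissibleStep_countable hstar root φ ih
  exact ⟨⋃ n, S n,
    admissible_iUnion_of_step hmono hcount (mem_insert root A) fun n => (hsucc n).ge,
    (subset_insert root A).trans (subset_iUnion S 0)⟩

end Admissible

theorem stmt3 {T : Type u} [PartialOrder T] [τ : TopologicalSpace T]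
    (hτ : τ = coarseWedge T) (htree : IsTreeOrder T) (hcc : ChainComplete T)
    (root : T) (hroot : ∀ x : T, root ≤ x)
    (hstar : StarCond T) (φ : T → ℕ → T) (hφ : PhiSpec root φ) :
    (∀ A B : Set T, Admissible root φ A → Admissible root φ B →
      ∃ C : Set T, Admissible root φ C ∧ A ⊆ C ∧ B ⊆ C) ∧
    (∀ A : ℕ → Set T, (∀ n, Admissible root φ (A n)) → Monotone A →
      Admissible root φ (⋃ n, A n) ∧ IsLUB (Set.range A) (⋃ n, A n)) := by
  refine ⟨fun A B hA hB => ?_, fun A hA hmono => ⟨Admissible.iUnion hA hmono, isLUB_iSup⟩⟩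
  obtain ⟨C, hC, hABC⟩ := hstar.exists_admissible_superset root φ (hA.countable.union hB.countable)
  exact ⟨C, hC, union_subset_iff.1 hABC⟩
end

section
/- Let T be a rooted chain complete tree satisfying condition (*), endowed with the coarse wedge topology, and let A ∈ 𝒜(T). If s, t ∈ cl(A), then s ∧ t ∈ cl(A); in fact, if s and t are incomparable elements of cl(A), then s ∧ t ∈ A. -/
open Cardinal Ordinal Filter Set Topology

universe u v

namespace IsTreeOrder

variable {T : Type u} [PartialOrder T]

theorem le_total_of_le (h : IsTreeOrder T) {x y z : T} (hy : y ≤ x) (hz : z ≤ x) :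
    y ≤ z ∨ z ≤ y := by
  rcases hy.eq_or_lt with rfl | hy
  · exact Or.inr hz
  rcases hz.eq_or_lt with rfl | hz
  · exact Or.inl hy.le
  have := h x
  rcases trichotomous_of (α := {y : T // y < x}) (· < ·) ⟨y, hy⟩ ⟨z, hz⟩ with h | h | h
  · exact Or.inl (le_of_lt (α := T) h)
  · exact Or.inl (congrArg Subtype.val h).le
  · exact Or.inr (le_of_lt (α := T) h)

theorem exists_covBy_le (h : IsTreeOrder T) {w s : T} (hws : w < s) :
    ∃ c, w ⋖ c ∧ c ≤ s := by
  by_cases hc : w ⋖ s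
  · exact ⟨s, hc, le_rfl⟩
  obtain ⟨y, hwy, hys⟩ := (not_covBy_iff hws).1 hc
  have := h s
  have wf : WellFounded ((· < ·) : {y : T // y < s} → _ → Prop) := IsWellFounded.wf
  obtain ⟨⟨m, hms⟩, hwm, hmin⟩ := wf.has_min {z | w < z.1} ⟨⟨y, hys⟩, hwy⟩
  exact ⟨m, ⟨hwm, fun c hwc hcm => hmin ⟨c, hcm.trans hms⟩ hwc hcm⟩, hms.le⟩

theorem htx_of_covBy (h : IsTreeOrder T) {w c : T} (hc : w ⋖ c) : htx c = htx w + 1 := by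
  have hw := h w
  have hcw := h c
  have key : ∀ y, y < c → y = w ∨ y < w := fun y hy => by
    rcases h.le_total_of_le hy.le hc.1.le with h1 | h1
    · exact h1.eq_or_lt
    · exact h1.eq_or_lt.elim (fun h => Or.inl h.symm) fun h => (hc.2 h hy).elim
  rw [htx, htx, dif_pos hcw, dif_pos hw, ← Ordinal.type_pUnit, ← Ordinal.type_sum_lex, Ordinal.type_eq]
  let f : {y : T // y < w} ⊕ PUnit.{u + 1} → {y : T // y < c} :=
    Sum.elim (fun y => ⟨y.1, y.2.trans hc.1⟩) fun _ => ⟨w, hc.1⟩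
  have hf : ∀ {a b}, f a < f b ↔ Sum.Lex (· < ·) emptyRelation a b := by
    rintro (a | a) (b | b)
    · rw [Sum.lex_inl_inl]; exact Iff.rfl
    · exact iff_of_true a.2 (Sum.Lex.sep _ _)
    · exact iff_of_false (fun h => lt_asymm (α := T) h b.2) Sum.lex_inr_inl
    · exact iff_of_false (lt_irrefl w) fun h => (Sum.lex_inr_inr.1 h).elim
  have inj : Function.Injective f := by
    rintro (a | a) (b | b) hab
    · exact congrArg Sum.inl (Subtype.ext (Subtype.mk.inj hab))
    · exact (a.2.ne (Subtype.mk.inj hab)).elim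
    · exact (b.2.ne' (Subtype.mk.inj hab)).elim
    · rfl
  refine ⟨(RelIso.ofSurjective ⟨⟨f, inj⟩, hf⟩ ?_).symm⟩
  rintro ⟨y, hy⟩
  rcases key y hy with rfl | hy'
  · exact ⟨Sum.inr PUnit.unit, rfl⟩
  · exact ⟨Sum.inl ⟨y, hy'⟩, rfl⟩

end IsTreeOrder

section Wedge

variable {T : Type u} [PartialOrder T]

theorem wedge_eq_of_isGreatest {s t m : T} (hm : IsGreatest {r : T | r ≤ s ∧ r ≤ t} m) :
    wedge s t = m := by
  have h : ∃ m, IsGreatest {r : T | r ≤ s ∧ r ≤ t} m := ⟨m, hm⟩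
  rw [wedge, dif_pos h]
  exact h.choose_spec.unique hm

theorem exists_isGreatest_common_le (htree : IsTreeOrder T) (hcc : ChainComplete T) (s t : T) :
    ∃ m, IsGreatest {r : T | r ≤ s ∧ r ≤ t} m := by
  obtain ⟨m, hm⟩ := hcc {r : T | r ≤ s ∧ r ≤ t}
    fun x hx y hy _ => htree.le_total_of_le hx.1 hy.1
  exact ⟨m, ⟨hm.2 fun _ h => h.1, hm.2 fun _ h => h.2⟩, hm.1⟩

theorem exists_mem_ge_of_mem_closure [τ : TopologicalSpace T] (hτ : τ = coarseWedge T)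
    {A : Set T} {s c : T} (hs : s ∈ closure A) (hc : SuccLevel c) (hcs : c ≤ s) :
    ∃ a ∈ A, c ≤ a := by
  have ho : IsOpen (Vset c) := by
    subst hτ
    exact TopologicalSpace.isOpen_generateFrom_of_mem ⟨c, Or.inr hc, Or.inl rfl⟩
  obtain ⟨a, hca, ha⟩ := mem_closure_iff.1 hs _ ho hcs
  exact ⟨a, ha, hca⟩

theorem wedge_mem_of_incomparable [τ : TopologicalSpace T] (hτ : τ = coarseWedge T)
    (htree : IsTreeOrder T) (hcc : ChainComplete T) {A : Set T}
    (hA : ∀ s ∈ A, ∀ t ∈ A, wedge s t ∈ A) {s t : T} (hs : s ∈ closure A) (ht : t ∈ closure A)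
    (hst : ¬ s ≤ t) (hts : ¬ t ≤ s) : wedge s t ∈ A := by
  obtain ⟨w, ⟨hws, hwt⟩, hmax⟩ := exists_isGreatest_common_le htree hcc s t
  rw [wedge_eq_of_isGreatest ⟨⟨hws, hwt⟩, hmax⟩]
  obtain ⟨c, hwc, hcs⟩ := htree.exists_covBy_le (hws.lt_of_ne fun h => hst (h ▸ hwt))
  obtain ⟨d, hwd, hdt⟩ := htree.exists_covBy_le (hwt.lt_of_ne fun h => hts (h ▸ hws))
  obtain ⟨a, ha, hca⟩ := exists_mem_ge_of_mem_closure hτ hs ⟨_, htree.htx_of_covBy hwc⟩ hcs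
  obtain ⟨b, hb, hdb⟩ := exists_mem_ge_of_mem_closure hτ ht ⟨_, htree.htx_of_covBy hwd⟩ hdt
  have le_of_covBy : ∀ {e x r : T}, w ⋖ e → e ≤ x → r ≤ x → w < r → e ≤ r := by
    intro e x r he hex hrx hwr
    rcases htree.le_total_of_le hex hrx with h | h
    · exact h
    · exact h.eq_or_lt.elim (fun h => h.ge) fun h => (he.2 hwr h).elim
  have hab : wedge a b = w := wedge_eq_of_isGreatest
    ⟨⟨hwc.1.le.trans hca, hwd.1.le.trans hdb⟩, fun r ⟨hra, hrb⟩ => by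
      rcases htree.le_total_of_le hra (hwc.1.le.trans hca) with h | h
      · exact h
      rcases h.eq_or_lt with h | h
      · exact h.ge
      have hcr := le_of_covBy hwc hca hra h
      have hdc := le_of_covBy hwd hdb (hcr.trans hrb) hwc.1
      have hcd := le_of_covBy hwc hcr (le_of_covBy hwd hdb hrb h) hwd.1
      exact (hwc.1.not_ge (hmax ⟨hcs, hcd.trans hdt⟩)).elim⟩
  exact hab ▸ hA a ha b hb

end Wedge

theorem stmt6 {T : Type u} [PartialOrder T] [τ : TopologicalSpace T]
    (hτ : τ = coarseWedge T) (htree : IsTreeOrder T) (hcc : ChainComplete T)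
    (root : T) (hroot : ∀ x : T, root ≤ x)
    (hstar : StarCond T) (φ : T → ℕ → T) (hφ : PhiSpec root φ)
    (A : Set T) (hA : Admissible root φ A) :
    (∀ s ∈ closure A, ∀ t ∈ closure A, wedge s t ∈ closure A) ∧
    (∀ s ∈ closure A, ∀ t ∈ closure A, ¬ s ≤ t → ¬ t ≤ s → wedge s t ∈ A) := by
  have hincomp : ∀ s ∈ closure A, ∀ t ∈ closure A, ¬ s ≤ t → ¬ t ≤ s → wedge s t ∈ A :=
    fun _ hs _ ht => wedge_mem_of_incomparable hτ htree hcc hA.wedge_mem hs ht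
  refine ⟨fun s hs t ht => ?_, hincomp⟩
  by_cases hst : s ≤ t
  · rwa [wedge_eq_of_isGreatest ⟨⟨le_rfl, hst⟩, fun _ h => h.1⟩]
  by_cases hts : t ≤ s
  · rwa [wedge_eq_of_isGreatest ⟨⟨hts, le_rfl⟩, fun _ h => h.2⟩]
  exact subset_closure (hincomp s hs t ht hst hts)
end
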